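/- Let p ∈ ℝ[x₁,…,xₙ] be a square-free real-zero polynomial of degree d. Then there exists a ∈ ℝⁿ such that 𝓗(p)(a) is positive definite; in particular det 𝓗(p) is not the zero polynomial, so 𝓗(p) is invertible as a matrix over the field of rational functions ℝ(x₁,…,xₙ). -/

import Mathlib

open Matrix

/-- Write `p = Σ_{i=0}^d p_i` with `p_i` homogeneous of degree `i`, and let
`P(x,t) = Σ_{i=0}^d p_i t^{d-i}` be the homogenization of `p` with respect to `t`.
This is the companion matrix `L_t` of `P` (as a monic polynomial in `t` of degree `d`):
subdiagonal entries `1`, last column `(-p_d, -p_{d-1}, …, -p_1)ᵀ`. -/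
noncomputable def companionM {n : ℕ} (d : ℕ) (p : MvPolynomial (Fin n) ℝ) :
    Matrix (Fin d) (Fin d) (MvPolynomial (Fin n) ℝ) := fun i j =>
  if (j : ℕ) = d - 1 then -(MvPolynomial.homogeneousComponent (d - (i : ℕ)) p)
  else if (i : ℕ) = (j : ℕ) + 1 then 1 else 0

/-- The parametrized Hermite matrix `𝓗(p)` of `p` (for `p` of degree `d`): the `d × d`
matrix over `ℝ[x₁,…,xₙ]` whose `(i,j)`-entry (1-based) is the Newton sum
`N_{i+j-2}(P) = trace (L_t^{i+j-2})`. -/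
noncomputable def hermiteM {n : ℕ} (d : ℕ) (p : MvPolynomial (Fin n) ℝ) :
    Matrix (Fin d) (Fin d) (MvPolynomial (Fin n) ℝ) := fun i j =>
  Matrix.trace (companionM d p ^ ((i : ℕ) + (j : ℕ)))

/-- A polynomial `p ∈ ℝ[x₁,…,xₙ]` with `p(0) = 1` is a real-zero polynomial if for every
`a ∈ ℝⁿ` all complex roots of the univariate polynomial `t ↦ p(ta)` are real. -/
def IsRealZero {n : ℕ} (p : MvPolynomial (Fin n) ℝ) : Prop :=
  MvPolynomial.constantCoeff p = 1 ∧
  ∀ (a : Fin n → ℝ) (z : ℂ),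
    (MvPolynomial.aeval (fun i => z * algebraMap ℝ ℂ (a i))) p = 0 → z.im = 0

/-- The symmetric linear matrix polynomial `𝓜 = x₁M₁ + ⋯ + xₙMₙ` determined by
matrices `M₁, …, Mₙ`. -/
noncomputable def pencil {n k : ℕ} (M : Fin n → Matrix (Fin k) (Fin k) ℝ) :
    Matrix (Fin k) (Fin k) (MvPolynomial (Fin n) ℝ) := fun i j =>
  ∑ l, MvPolynomial.X l * MvPolynomial.C (M l i j)

/-- The homogenization `P(x,t) = Σ pᵢ t^{d-i}` of a polynomial with constant term `1`, as a monic
polynomial in `t`. -/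
noncomputable def homogenization {n : ℕ} (d : ℕ) (p : MvPolynomial (Fin n) ℝ) :
    Polynomial (MvPolynomial (Fin n) ℝ) :=
  Polynomial.X ^ d +
    ∑ i : Fin d, Polynomial.C (MvPolynomial.homogeneousComponent (d - (i : ℕ)) p) *
      Polynomial.X ^ (i : ℕ)

section Homogenization

variable {n d : ℕ} {p : MvPolynomial (Fin n) ℝ}

theorem degree_homogenization_tail_lt (d : ℕ) (p : MvPolynomial (Fin n) ℝ) :
    (∑ i : Fin d, Polynomial.C (MvPolynomial.homogeneousComponent (d - (i : ℕ)) p) *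
      Polynomial.X ^ (i : ℕ)).degree < (d : WithBot ℕ) := by
  refine (Polynomial.degree_sum_le _ _).trans_lt
    ((Finset.sup_lt_iff (WithBot.bot_lt_coe d)).2 fun i _ => ?_)
  exact (Polynomial.degree_C_mul_X_pow_le _ _).trans_lt (WithBot.coe_lt_coe.2 i.2)

theorem homogenization_monic (d : ℕ) (p : MvPolynomial (Fin n) ℝ) :
    (homogenization d p).Monic :=
  Polynomial.monic_X_pow_add (degree_homogenization_tail_lt d p)

theorem natDegree_homogenization (d : ℕ) (p : MvPolynomial (Fin n) ℝ) :
    (homogenization d p).natDegree = d := by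
  apply Polynomial.natDegree_eq_of_degree_eq_some
  rw [homogenization, Polynomial.degree_add_eq_left_of_degree_lt, Polynomial.degree_X_pow]
  rw [Polynomial.degree_X_pow]
  exact degree_homogenization_tail_lt d p

theorem aeval_smul_homogeneousComponent {A : Type*} [CommRing A] [Algebra ℝ A]
    (x : Fin n → A) (s : A) (m : ℕ) (p : MvPolynomial (Fin n) ℝ) :
    MvPolynomial.aeval (fun i => s * x i) (MvPolynomial.homogeneousComponent m p) =
      s ^ m * MvPolynomial.aeval x (MvPolynomial.homogeneousComponent m p) := by
  have h := MvPolynomial.homogeneousComponent_isHomogeneous m p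
  rw [MvPolynomial.aeval_def, MvPolynomial.aeval_def, MvPolynomial.eval₂_eq,
    MvPolynomial.eval₂_eq, Finset.mul_sum]
  refine Finset.sum_congr rfl fun e he => ?_
  have he' : ∑ i ∈ e.support, e i = m := by
    rw [← h.degree_eq_sum_deg_support he]
  simp only [mul_pow, Finset.prod_mul_distrib, Finset.prod_pow_eq_pow_sum, he']
  ring

/-- Dehomogenization: `p(s x) = s ^ d * P(x, 1 / s)`. -/
theorem aeval_smul_eq_eval₂_homogenization {A : Type*} [CommRing A] [Algebra ℝ A]
    (h0 : MvPolynomial.constantCoeff p = 1) (hdeg : p.totalDegree = d)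
    (x : Fin n → A) {s t : A} (hst : s * t = 1) :
    MvPolynomial.aeval (fun i => s * x i) p =
      s ^ d * (homogenization d p).eval₂ (MvPolynomial.aeval x : _ →ₐ[ℝ] A).toRingHom t := by
  have hpow : ∀ i ≤ d, s ^ d * t ^ i = s ^ (d - i) := fun i hi => by
    rw [← Nat.sub_add_cancel hi, pow_add, mul_assoc, ← mul_pow, hst, one_pow, mul_one,
      Nat.add_sub_cancel]
  conv_lhs => rw [← MvPolynomial.sum_homogeneousComponent p, hdeg, map_sum,
    ← Finset.sum_range_reflect, Finset.sum_range_succ]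
  rw [homogenization, Polynomial.eval₂_add, Polynomial.eval₂_pow, Polynomial.eval₂_X,
    Polynomial.eval₂_finsetSum, mul_add, hpow d le_rfl, add_comm, Finset.mul_sum,
    Finset.sum_range]
  congr 1
  · rw [MvPolynomial.constantCoeff_eq] at h0
    simp [h0]
  · refine Finset.sum_congr rfl fun i _ => ?_
    rw [Polynomial.eval₂_mul, Polynomial.eval₂_C, Polynomial.eval₂_pow, Polynomial.eval₂_X,
      mul_left_comm, hpow i i.2.le, show d + 1 - 1 - (i : ℕ) = d - i by omega,
      aeval_smul_homogeneousComponent, mul_comm]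
    rfl

theorem homogeneousComponent_totalDegree_ne_zero (hp : p ≠ 0) :
    MvPolynomial.homogeneousComponent p.totalDegree p ≠ 0 := by
  obtain ⟨e, he, hmax⟩ := Finset.exists_mem_eq_sup p.support
    (MvPolynomial.support_nonempty.2 hp) (fun e => e.sum fun _ k => k)
  intro h
  have := congr(MvPolynomial.coeff e $h)
  rw [MvPolynomial.coeff_homogeneousComponent, if_pos, MvPolynomial.coeff_zero] at this
  · exact MvPolynomial.mem_support_iff.1 he this
  · exact hmax.symm

theorem coeff_zero_homogenization (hd : d ≠ 0) :
    (homogenization d p).coeff 0 = MvPolynomial.homogeneousComponent d p := by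
  obtain ⟨d, rfl⟩ := Nat.exists_eq_succ_of_ne_zero hd
  simp [homogenization, Fin.sum_univ_succ,
    Polynomial.coeff_zero_eq_eval_zero, Polynomial.eval_finsetSum]

theorem map_eval_zero_homogenization (d : ℕ) (p : MvPolynomial (Fin n) ℝ) :
    (homogenization d p).map (MvPolynomial.eval (0 : Fin n → ℝ)) = Polynomial.X ^ d := by
  have h (i : Fin d) : MvPolynomial.constantCoeff
      (MvPolynomial.homogeneousComponent (d - (i : ℕ)) p) = 0 := by
    have hi : d - (i : ℕ) ≠ 0 := by omega
    have := MvPolynomial.coeff_homogeneousComponent (d - (i : ℕ)) p 0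
    rwa [if_neg (by simpa using hi.symm), ← MvPolynomial.constantCoeff_eq] at this
  simp [homogenization, Polynomial.map_sum, h]

/-- For square-free `p`, specializations at points of `ℝⁿ` do not change a factor whose square
divides the homogenization. -/
theorem map_eval_eq_of_mul_self_dvd_homogenization
    (h0 : MvPolynomial.constantCoeff p = 1) (hdeg : p.totalDegree = d) (hsf : Squarefree p)
    {q : Polynomial (MvPolynomial (Fin n) ℝ)} (hq : q * q ∣ homogenization d p)
    (b : Fin n → ℝ) :
    q.map (MvPolynomial.eval b) = q.map (MvPolynomial.eval 0) := by
  refine Polynomial.eq_of_infinite_eval_eq _ _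
    (((Set.finite_singleton (0 : ℝ)).infinite_compl).mono fun t (ht : t ≠ 0) => ?_)
  set x : Fin n → MvPolynomial (Fin n) ℝ := fun i => MvPolynomial.C t * MvPolynomial.X i with hx
  let φ : Polynomial (MvPolynomial (Fin n) ℝ) →+* MvPolynomial (Fin n) ℝ :=
    Polynomial.eval₂RingHom (MvPolynomial.aeval x : _ →ₐ[ℝ] _).toRingHom (MvPolynomial.C t)
  have hinv : (MvPolynomial.C t⁻¹ : MvPolynomial (Fin n) ℝ) * MvPolynomial.C t = 1 := by
    rw [← map_mul, inv_mul_cancel₀ ht, map_one]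
  have hdehom := aeval_smul_eq_eval₂_homogenization h0 hdeg x hinv
  have hX : (fun i => MvPolynomial.C t⁻¹ * x i) = MvPolynomial.X := by
    funext i
    rw [hx, ← mul_assoc, hinv, one_mul]
  rw [hX, MvPolynomial.aeval_X_left_apply] at hdehom
  have hdvd : φ q * φ q ∣ p := by
    rw [← map_mul, hdehom]
    exact (map_dvd φ hq).mul_left _
  obtain ⟨c, -, hc⟩ := MvPolynomial.isUnit_iff_eq_C_of_isReduced.1 (hsf _ hdvd)
  have hev (a : Fin n → ℝ) : (q.map (MvPolynomial.eval (fun i => t * a i))).eval t = c := by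
    have := congr(MvPolynomial.eval a $hc)
    rw [MvPolynomial.eval_C] at this
    rw [← this, Polynomial.eval_map, Polynomial.coe_eval₂RingHom, Polynomial.hom_eval₂,
      MvPolynomial.eval_C]
    congr 1
    ext i <;> simp [hx]
  have hb := hev fun i => t⁻¹ * b i
  have hz := hev 0
  simp only [mul_inv_cancel_left₀ ht] at hb
  simp only [Pi.zero_apply, mul_zero] at hz
  exact hb.trans hz.symm

theorem natDegree_eq_zero_of_mul_self_dvd_homogenization
    (h0 : MvPolynomial.constantCoeff p = 1) (hdeg : p.totalDegree = d) (hsf : Squarefree p)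
    {q : Polynomial (MvPolynomial (Fin n) ℝ)} (hqm : q.Monic)
    (hq : q * q ∣ homogenization d p) : q.natDegree = 0 := by
  by_contra hne
  have hdvd (b : Fin n → ℝ) : q.map (MvPolynomial.eval b) ∣
      (homogenization d p).map (MvPolynomial.eval b) :=
    Polynomial.map_dvd _ ((dvd_mul_right q q).trans hq)
  obtain ⟨m, -, hm⟩ := (dvd_prime_pow Polynomial.prime_X d).1
    (map_eval_zero_homogenization d p ▸ hdvd 0)
  have hm0 : m ≠ 0 := by
    rintro rfl
    rw [pow_zero, associated_one_iff_isUnit] at hm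
    have := Polynomial.natDegree_eq_zero_of_isUnit hm
    rw [hqm.natDegree_map] at this
    exact hne this
  have hd : d ≠ 0 := by
    have := Polynomial.natDegree_le_of_dvd ((dvd_mul_right q q).trans hq)
      (homogenization_monic d p).ne_zero
    rw [natDegree_homogenization] at this
    omega
  have hp : p ≠ 0 := by
    rintro rfl
    simp at h0
  refine homogeneousComponent_totalDegree_ne_zero hp (MvPolynomial.funext fun b => ?_)
  have hX : Polynomial.X ∣ (homogenization d p).map (MvPolynomial.eval b) :=
    ((dvd_pow_self _ hm0).trans hm.symm.dvd).trans
      (map_eval_eq_of_mul_self_dvd_homogenization h0 hdeg hsf hq b ▸ hdvd b)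
  rwa [Polynomial.X_dvd_iff, Polynomial.coeff_map, coeff_zero_homogenization hd, ← hdeg] at hX

theorem separable_map_homogenization
    (h0 : MvPolynomial.constantCoeff p = 1) (hdeg : p.totalDegree = d) (hsf : Squarefree p) :
    ((homogenization d p).map (algebraMap (MvPolynomial (Fin n) ℝ)
      (FractionRing (MvPolynomial (Fin n) ℝ)))).Separable := by
  have : CharZero (FractionRing (MvPolynomial (Fin n) ℝ)) :=
    charZero_of_injective_algebraMap
      (IsFractionRing.injective (MvPolynomial (Fin n) ℝ) _)
  rw [PerfectField.separable_iff_squarefree]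
  intro g hg
  have hmon := homogenization_monic d p
  have hg0 : g ≠ 0 := by
    rintro rfl
    rw [zero_mul, zero_dvd_iff] at hg
    exact (hmon.map _).ne_zero hg
  obtain ⟨q, hq⟩ := IsIntegrallyClosed.eq_map_mul_C_of_dvd _ hmon ((dvd_mul_right g g).trans hg)
  have hinj := IsFractionRing.injective (MvPolynomial (Fin n) ℝ)
    (FractionRing (MvPolynomial (Fin n) ℝ))
  have hlead : IsUnit (Polynomial.C g.leadingCoeff) :=
    Polynomial.isUnit_C.2 (Polynomial.leadingCoeff_ne_zero.2 hg0).isUnit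
  have hqm : q.Monic := by
    have := congr(Polynomial.leadingCoeff $hq)
    rw [Polynomial.leadingCoeff_mul, Polynomial.leadingCoeff_C,
      Polynomial.leadingCoeff_map_of_injective hinj] at this
    have h1 := mul_right_cancel₀ (Polynomial.leadingCoeff_ne_zero.2 hg0)
      (this.trans (one_mul _).symm)
    exact hinj (h1.trans (map_one _).symm)
  have hdvd : q * q ∣ homogenization d p := by
    rw [← Polynomial.map_dvd_map _ hinj (hqm.mul hqm), Polynomial.map_mul]
    refine Dvd.dvd.trans ?_ hg
    conv_rhs => rw [← hq]
    exact mul_dvd_mul (dvd_mul_right _ _) (dvd_mul_right _ _)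
  have hq1 := Polynomial.eq_one_of_monic_natDegree_zero hqm
    (natDegree_eq_zero_of_mul_self_dvd_homogenization h0 hdeg hsf hqm hdvd)
  rw [← hq, hq1, Polynomial.map_one, one_mul]
  exact hlead

theorem exists_separable_map_eval_homogenization
    (h0 : MvPolynomial.constantCoeff p = 1) (hdeg : p.totalDegree = d) (hsf : Squarefree p) :
    ∃ a : Fin n → ℝ, ((homogenization d p).map (MvPolynomial.eval a)).Separable := by
  have : CharZero (FractionRing (MvPolynomial (Fin n) ℝ)) :=
    charZero_of_injective_algebraMap
      (IsFractionRing.injective (MvPolynomial (Fin n) ℝ) _)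
  have key {K : Type} [Field K] [CharZero K] (f : MvPolynomial (Fin n) ℝ →+* K) :
      ((homogenization d p).map f).Separable ↔
        f ((homogenization d p).resultant (homogenization d p).derivative d (d - 1)) ≠ 0 := by
    have hm := (homogenization_monic d p).map f
    have hnat : ((homogenization d p).map f).natDegree = d := by
      rw [(homogenization_monic d p).natDegree_map, natDegree_homogenization]
    have hder : ((homogenization d p).map f).derivative.natDegree = d - 1 := by
      rw [Polynomial.natDegree_derivative, hnat]
    rw [Polynomial.separable_def, ← Polynomial.isUnit_resultant_iff_isCoprime hm, hnat, hder,
      Polynomial.derivative_map, Polynomial.resultant_map_map, isUnit_iff_ne_zero]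
  have hres := (key _).1 (separable_map_homogenization h0 hdeg hsf)
  simp only [key]
  by_contra! h
  refine hres ?_
  rw [MvPolynomial.funext (q := 0) (p := Polynomial.resultant _ _ _ _) (by simpa using h),
    map_zero]

theorem im_eq_zero_of_aeval_homogenization_eq_zero (hRZ : IsRealZero p)
    (hdeg : p.totalDegree = d) (a : Fin n → ℝ) {z : ℂ}
    (hz : Polynomial.aeval z ((homogenization d p).map (MvPolynomial.eval a)) = 0) :
    z.im = 0 := by
  by_cases hz0 : z = 0
  · rw [hz0, Complex.zero_im]
  have h := aeval_smul_eq_eval₂_homogenization hRZ.1 hdeg (fun i => algebraMap ℝ ℂ (a i))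
    (inv_mul_cancel₀ hz0)
  have hev : (homogenization d p).eval₂
      (MvPolynomial.aeval fun i => algebraMap ℝ ℂ (a i) : _ →ₐ[ℝ] ℂ).toRingHom z = 0 := by
    rw [← hz, Polynomial.aeval_def, Polynomial.eval₂_map]
    congr 1
    ext i <;> simp
  rw [hev, mul_zero] at h
  have := hRZ.2 a _ h
  rw [← inv_inv z, Complex.inv_im, this, neg_zero, zero_div]

theorem exists_injective_roots_map_eval_homogenization (hRZ : IsRealZero p)
    (hdeg : p.totalDegree = d) {a : Fin n → ℝ}
    (hsep : ((homogenization d p).map (MvPolynomial.eval a)).Separable) :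
    ∃ v : Fin d → ℝ, Function.Injective v ∧
      ∀ k, ((homogenization d p).map (MvPolynomial.eval a)).eval (v k) = 0 := by
  have hcard := Polynomial.card_rootSet_eq_natDegree (K := ℂ) hsep (IsAlgClosed.splits _)
  rw [(homogenization_monic d p).natDegree_map, natDegree_homogenization] at hcard
  let e := (Fintype.equivFinOfCardEq hcard).symm
  have hroot (k : Fin d) : Polynomial.aeval (e k : ℂ)
      ((homogenization d p).map (MvPolynomial.eval a)) = 0 :=
    (Polynomial.mem_rootSet.1 (e k).2).2
  have hre (k : Fin d) : algebraMap ℝ ℂ (e k : ℂ).re = e k :=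
    Complex.ext rfl (im_eq_zero_of_aeval_homogenization_eq_zero hRZ hdeg a (hroot k)).symm
  refine ⟨fun k => (e k : ℂ).re, fun i j hij => e.injective (Subtype.ext ?_), fun k => ?_⟩
  · rw [← hre i, ← hre j]
    exact congrArg _ hij
  · have := hroot k
    rw [← hre k, Polynomial.aeval_algebraMap_apply, Polynomial.coe_aeval_eq_eval] at this
    exact (algebraMap ℝ ℂ).injective (this.trans (map_zero _).symm)

/-- The Vandermonde matrix of roots of `P(a, ·)` intertwines the companion matrix at `a` with
the diagonal matrix of these roots. -/
theorem vandermonde_mul_companionM_map_eval {a : Fin n → ℝ} {v : Fin d → ℝ}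
    (hv : ∀ k, ((homogenization d p).map (MvPolynomial.eval a)).eval (v k) = 0) :
    vandermonde v * (companionM d p).map (MvPolynomial.eval a) = diagonal v * vandermonde v := by
  ext k j
  rw [diagonal_mul, mul_apply, vandermonde_apply, ← pow_succ']
  by_cases hj : (j : ℕ) = d - 1
  · have := hv k
    simp only [homogenization, Polynomial.map_add, Polynomial.map_pow, Polynomial.map_X,
      Polynomial.map_sum, Polynomial.map_mul, Polynomial.map_C, Polynomial.eval_add,
      Polynomial.eval_pow, Polynomial.eval_X, Polynomial.eval_finsetSum, Polynomial.eval_mul,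
      Polynomial.eval_C] at this
    rw [show (j : ℕ) + 1 = d by omega, eq_neg_of_add_eq_zero_left this, ← Finset.sum_neg_distrib]
    refine Finset.sum_congr rfl fun i _ => ?_
    simp [companionM, hj, vandermonde_apply, mul_comm]
  · rw [Finset.sum_eq_single ⟨j + 1, by omega⟩]
    · simp [companionM, hj, vandermonde_apply]
    · intro i _ hi
      have : (i : ℕ) ≠ j + 1 := fun h => hi (Fin.ext h)
      simp [companionM, hj, this]
    · simp

theorem hermiteM_map_eval_eq {a : Fin n → ℝ} {v : Fin d → ℝ} (hinj : Function.Injective v)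
    (hv : ∀ k, ((homogenization d p).map (MvPolynomial.eval a)).eval (v k) = 0) :
    (hermiteM d p).map (MvPolynomial.eval a) = (vandermonde v)ᵀ * vandermonde v := by
  set M := (companionM d p).map (MvPolynomial.eval a) with hM
  have hdet : IsUnit (vandermonde v).det := (det_vandermonde_ne_zero_iff.2 hinj).isUnit
  have hpow (m : ℕ) : vandermonde v * M ^ m = diagonal v ^ m * vandermonde v :=
    (show SemiconjBy (vandermonde v) M (diagonal v) from
      vandermonde_mul_companionM_map_eval hv).pow_right m
  have htr (m : ℕ) : (M ^ m).trace = ∑ k, v k ^ m := by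
    rw [← nonsing_inv_mul_cancel_left _ (M ^ m) hdet, hpow, trace_mul_comm,
      mul_nonsing_inv_cancel_right _ _ hdet, diagonal_pow, trace_diagonal]
    rfl
  ext i j
  rw [vandermonde_transpose_mul_vandermonde, map_apply, hermiteM, ← htr, hM,
    AddMonoidHom.map_trace]
  exact congrArg trace (map_pow (MvPolynomial.eval a).mapMatrix (companionM d p) _)

end Homogenization

theorem exists_posDef_hermiteM_map_eval {n : ℕ} {p : MvPolynomial (Fin n) ℝ} {d : ℕ}
    (hRZ : IsRealZero p) (hsf : Squarefree p) (hdeg : p.totalDegree = d) :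
    ∃ a : Fin n → ℝ, ((hermiteM d p).map (MvPolynomial.eval a)).PosDef := by
  obtain ⟨a, ha⟩ := exists_separable_map_eval_homogenization hRZ.1 hdeg hsf
  obtain ⟨v, hinj, hv⟩ := exists_injective_roots_map_eval_homogenization hRZ hdeg ha
  refine ⟨a, ?_⟩
  rw [hermiteM_map_eval_eq hinj hv, ← conjTranspose_eq_transpose_of_trivial]
  refine PosDef.conjTranspose_mul_self _ (mulVec_injective_of_isUnit ?_)
  exact (isUnit_iff_isUnit_det _).2 (det_vandermonde_ne_zero_iff.2 hinj).isUnit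

/-- Let `p` be a square-free real-zero polynomial of degree `d`. Then `𝓗(p)(a)` is positive
definite for some `a ∈ ℝⁿ`; in particular `det 𝓗(p)` is not the zero polynomial, and
`𝓗(p)` is invertible as a matrix over the field of rational functions `ℝ(x₁,…,xₙ)`. -/
theorem hermite_generically_posDef {n : ℕ} (p : MvPolynomial (Fin n) ℝ) (d : ℕ)
    (hRZ : IsRealZero p) (hsf : Squarefree p) (hdeg : p.totalDegree = d) :
    (∃ a : Fin n → ℝ, ((hermiteM d p).map (MvPolynomial.eval a)).PosDef) ∧
    Matrix.det (hermiteM d p) ≠ 0 ∧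
    IsUnit ((hermiteM d p).map
      (algebraMap (MvPolynomial (Fin n) ℝ) (FractionRing (MvPolynomial (Fin n) ℝ)))) := by
  obtain ⟨a, ha⟩ := exists_posDef_hermiteM_map_eval hRZ hsf hdeg
  have hdet : (hermiteM d p).det ≠ 0 := by
    intro h
    have := ha.det_pos
    rw [← RingHom.mapMatrix_apply, ← RingHom.map_det, h, map_zero] at this
    exact this.false
  refine ⟨⟨a, ha⟩, hdet, ?_⟩
  rw [isUnit_iff_isUnit_det, ← RingHom.mapMatrix_apply, ← RingHom.map_det, isUnit_iff_ne_zero]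
  exact (map_ne_zero_iff _ (IsFractionRing.injective _ _)).2 hdet
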